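/- arXiv:1909.03636 — 4 statements merged into one kernel-verified Lean document; each statement's English description precedes it below -/
import Mathlib

section
/- There is an absolute constant C > 0 such that for all integers n ≥ 2 and all integers k with 1 ≤ k ≤ n, there exists a strong (n,k)-selector of length at most C·k²·log n. -/
open Classical in
/-- Halving cover lemma. -/
theorem cover_aux {P F : Type*} [Fintype F] [Nonempty F] (bad : P → F → Prop)
    (hbad : ∀ p, 2 * (Finset.univ.filter (fun f => bad p f)).card ≤ Fintype.card F) :
    ∀ (m : ℕ) (T : Finset P), T.card < 2 ^ m →
      ∃ G : Fin m → F, ∀ p ∈ T, ∃ j, ¬ bad p (G j) := by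
  intro m
  induction m with
  | zero =>
    intro T hT
    have : T = ∅ := by simpa using hT
    subst this
    exact ⟨fun i => i.elim0, by simp⟩
  | succ m ih =>
    intro T hT
    have hsum : ∑ f : F, 2 * (T.filter (fun p => bad p f)).card ≤ ∑ _f : F, T.card := by
      rw [← Finset.mul_sum]
      have h1 : ∑ f : F, (T.filter (fun p => bad p f)).card
          = ∑ p ∈ T, (Finset.univ.filter (fun f => bad p f)).card := by
        simp only [Finset.card_filter]
        exact Finset.sum_comm
      rw [h1, Finset.mul_sum]
      calc _ ≤ ∑ p ∈ T, Fintype.card F := Finset.sum_le_sum (fun p _ => hbad p)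
        _ = _ := by simp [mul_comm]
    obtain ⟨f, -, hf⟩ := Finset.exists_le_of_sum_le Finset.univ_nonempty hsum
    obtain ⟨G, hG⟩ := ih (T.filter (fun p => bad p f)) (by rw [pow_succ] at hT; omega)
    refine ⟨Fin.cons f G, fun p hp => ?_⟩
    by_cases hb : bad p f
    · obtain ⟨j, hj⟩ := hG p (by simp [hp, hb])
      exact ⟨j.succ, by simpa using hj⟩
    · exact ⟨0, by simpa using hb⟩

theorem collide_card {n c : ℕ} (x y : Fin n) (h : y ≠ x) :
    (Finset.univ.filter (fun f : Fin n → Fin c => f y = f x)).card * c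
      ≤ Fintype.card (Fin n → Fin c) := by
  have : ((Finset.univ.filter (fun f : Fin n → Fin c => f y = f x)) ×ˢ
      (Finset.univ : Finset (Fin c))).card ≤ (Finset.univ : Finset (Fin n → Fin c)).card := by
    apply Finset.card_le_card_of_injOn (fun q => Function.update q.1 x q.2) (by simp)
    rintro ⟨f, a⟩ hf ⟨g, b⟩ hg hfg
    simp at hf hg hfg
    have h1 : a = b := by simpa using congrFun hfg x
    have h2 : ∀ z, z ≠ x → f z = g z := fun z hz => by
      simpa [Function.update_of_ne hz] using congrFun hfg z
    have h3 : f = g := by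
      funext z
      by_cases hz : z = x
      · subst hz; rw [← hf, ← hg]; exact h2 y h
      · exact h2 z hz
    rw [h1, h3]
  simpa [Finset.card_product] using this

open Classical in
theorem bad_card {n k : ℕ} (hk : 1 ≤ k) (p : (Fin k → Fin n) × Fin n) :
    2 * (Finset.univ.filter (fun f : Fin n → Fin (2 * k) =>
      ∃ i, p.1 i ≠ p.2 ∧ f (p.1 i) = f p.2)).card ≤ Fintype.card (Fin n → Fin (2 * k)) := by
  have h1 : (Finset.univ.filter (fun f : Fin n → Fin (2 * k) =>
      ∃ i, p.1 i ≠ p.2 ∧ f (p.1 i) = f p.2)) ⊆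
      Finset.univ.biUnion (fun i : Fin k => Finset.univ.filter
        (fun f : Fin n → Fin (2 * k) => p.1 i ≠ p.2 ∧ f (p.1 i) = f p.2)) := by
    intro f hf
    simpa using hf
  have h2 := (Finset.card_le_card h1).trans Finset.card_biUnion_le
  have h3 : ∀ i : Fin k, (Finset.univ.filter
        (fun f : Fin n → Fin (2 * k) => p.1 i ≠ p.2 ∧ f (p.1 i) = f p.2)).card * (2 * k)
        ≤ Fintype.card (Fin n → Fin (2 * k)) := by
    intro i
    by_cases h : p.1 i = p.2
    · simp [h]
    · have := collide_card (c := 2 * k) p.2 (p.1 i) h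
      simpa only [ne_eq, h, not_false_eq_true, true_and] using this
  have h4 := Finset.sum_le_sum (s := Finset.univ) (fun i _ => h3 i)
  rw [← Finset.sum_mul] at h4
  rw [Finset.sum_const, Finset.card_univ, Fintype.card_fin, smul_eq_mul] at h4
  have h5 := (Nat.mul_le_mul_right (2 * k) h2).trans h4
  exact Nat.le_of_mul_le_mul_left (by linarith) hk


/-- There is an absolute constant `C > 0` such that for all integers
`n ≥ 2` and all integers `k` with `1 ≤ k ≤ n`, there exists a strong `(n,k)`-selector
of length at most `C·k²·log n` (log base 2).

A strong `(n,k)`-selector is a finite sequence `S : Fin ℓ → Finset (Fin n)` such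
that for every `X ⊆ {0,…,n−1}` with `|X| ≤ k` and every `x ∈ X` there is an index
`i < ℓ` with `S i ∩ X = {x}`. -/
theorem strong_selector_exists :
    ∃ C : ℝ, 0 < C ∧
      ∀ n k : ℕ, 2 ≤ n → 1 ≤ k → k ≤ n →
        ∃ (ℓ : ℕ) (S : Fin ℓ → Finset (Fin n)),
          (∀ X : Finset (Fin n), X.card ≤ k →
            ∀ x ∈ X, ∃ i : Fin ℓ, S i ∩ X = {x}) ∧
          (ℓ : ℝ) ≤ C * (k : ℝ) ^ 2 * Real.logb 2 n := by
  classical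
  refine ⟨8, by norm_num, fun n k hn hk hkn => ?_⟩
  set L := Nat.log 2 n with hL
  have hL1 : 1 ≤ L := Nat.log_pos (by norm_num) hn
  have : Nonempty (Fin n → Fin (2 * k)) := ⟨fun _ => ⟨0, by omega⟩⟩
  obtain ⟨G, hG⟩ := cover_aux (fun (p : (Fin k → Fin n) × Fin n) (f : Fin n → Fin (2 * k)) =>
      ∃ i, p.1 i ≠ p.2 ∧ f (p.1 i) = f p.2) (fun p => by convert bad_card hk p) ((L + 1) * (k + 1))
      Finset.univ (by
        have h : n < 2 ^ (L + 1) := Nat.lt_pow_succ_log_self (by norm_num) n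
        have := Nat.pow_lt_pow_left h (n := k + 1) (by omega)
        rw [← pow_mul] at this
        simpa [← pow_succ] using this)
  refine ⟨(L + 1) * (k + 1) * (2 * k), fun q => Finset.univ.filter
    (fun z => G (finProdFinEquiv.symm q).1 z = (finProdFinEquiv.symm q).2), ?_, ?_⟩
  · intro X hX x hx
    obtain ⟨j, hj⟩ := hG (fun i => if h : i.1 < X.card then (X.equivFin.symm ⟨i.1, h⟩ : Fin n)
      else x, x) (Finset.mem_univ _)
    push Not at hj
    refine ⟨finProdFinEquiv (j, G j x), ?_⟩
    ext z
    simp only [Equiv.symm_apply_apply, Finset.mem_inter, Finset.mem_filter, Finset.mem_univ,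
      true_and, Finset.mem_singleton]
    constructor
    · rintro ⟨hz, hzX⟩
      by_contra hne
      have hlt := (X.equivFin ⟨z, hzX⟩).2
      have := hj ⟨(X.equivFin ⟨z, hzX⟩).1, hlt.trans_le hX⟩
      simp [hne, hz] at this
    · rintro rfl
      exact ⟨rfl, hx⟩
  · have hlog : (L : ℝ) ≤ Real.logb 2 n := by
      rw [Real.le_logb_iff_rpow_le (by norm_num) (by positivity), Real.rpow_natCast]
      exact_mod_cast Nat.pow_log_le_self 2 (by omega)
    have h : (L + 1) * (k + 1) * (2 * k) ≤ 8 * k ^ 2 * L := by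
      calc _ ≤ (L + L) * (k + k) * (2 * k) := by gcongr
        _ = _ := by ring
    calc (((L + 1) * (k + 1) * (2 * k) : ℕ) : ℝ) ≤ ((8 * k ^ 2 * L : ℕ) : ℝ) := by exact_mod_cast h
      _ = 8 * (k : ℝ) ^ 2 * L := by push_cast; ring
      _ ≤ _ := by gcongr
end

section
/- There is an absolute constant C > 0 such that for all integers n ≥ 2 and all integers k with 1 ≤ k ≤ n, there exists an (n,k)-half-selector of length at most C·k·log n. -/
theorem hs_pow_self_le (r : ℕ) : r ^ r ≤ 4 ^ r * r.factorial := by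
  have h := Real.pow_div_factorial_le_exp (r : ℝ) (Nat.cast_nonneg r) r
  have h2 : Real.exp (r : ℝ) ≤ 4 ^ r := by
    rw [← Real.exp_one_pow]
    have := Real.exp_one_lt_d9
    exact pow_le_pow_left₀ (Real.exp_pos 1).le (by linarith) r
  have h3 : (0 : ℝ) < r.factorial := by exact_mod_cast r.factorial_pos
  rw [div_le_iff₀ h3] at h
  have h4 : (r : ℝ) ^ r ≤ 4 ^ r * r.factorial := h.trans (by gcongr)
  exact_mod_cast h4

theorem hs_key (q m r : ℕ) (hr : r = 3 * m / 4) (hq : 1024 * m ≤ q) :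
    q.choose r * r ^ m * 2 ^ m ≤ q ^ m := by
  obtain ⟨d, hd⟩ : ∃ d, m = r + d := ⟨m - r, by omega⟩
  have h1 : m ≤ 4 * d := by omega
  have h2 : r ≤ 3 * d := by omega
  have hc : q.choose r * r.factorial ≤ q ^ r := by
    rw [mul_comm, ← Nat.descFactorial_eq_factorial_mul_choose]
    exact Nat.descFactorial_le_pow q r
  have hs := hs_pow_self_le r
  have e1 : (2 : ℕ) ^ m ≤ 16 ^ d := by
    calc (2 : ℕ) ^ m ≤ 2 ^ (4 * d) := Nat.pow_le_pow_right (by norm_num) h1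
      _ = 16 ^ d := by rw [pow_mul]; norm_num
  have e2 : (4 : ℕ) ^ r ≤ 64 ^ d := by
    calc (4 : ℕ) ^ r ≤ 4 ^ (3 * d) := Nat.pow_le_pow_right (by norm_num) h2
      _ = 64 ^ d := by rw [pow_mul]; norm_num
  refine Nat.le_of_mul_le_mul_right ?_ r.factorial_pos
  calc q.choose r * r ^ m * 2 ^ m * r.factorial
      = (q.choose r * r.factorial) * (r ^ r * r ^ d) * 2 ^ m := by
        rw [← pow_add, ← hd]; ring
    _ ≤ q ^ r * ((64 ^ d * r.factorial) * r ^ d) * 16 ^ d := by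
        gcongr
        exact hs.trans (by gcongr)
    _ = q ^ r * (1024 * r) ^ d * r.factorial := by
        rw [show (1024 : ℕ) = 64 * 16 by norm_num, mul_pow, mul_pow]; ring
    _ ≤ q ^ r * q ^ d * r.factorial := by
        gcongr
        omega
    _ = q ^ m * r.factorial := by rw [← pow_add, ← hd]

/-- Functions whose image on `X` is small. -/
def hsBad (n q : ℕ) (X : Finset (Fin n)) : Finset (Fin n → Fin q) :=
  Finset.univ.filter fun f => 4 * (X.image f).card ≤ 3 * X.card

theorem hs_bad_card (n q : ℕ) (X : Finset (Fin n)) (hq : 1024 * X.card ≤ q) :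
    (hsBad n q X).card * 2 ^ X.card ≤ q ^ n := by
  classical
  set m := X.card with hm
  set r := 3 * m / 4 with hr
  have hmn : m ≤ n := by simpa using Finset.card_le_univ X
  have hsub : hsBad n q X ⊆ (Finset.powersetCard r (Finset.univ : Finset (Fin q))).biUnion
      (fun T => Fintype.piFinset (fun i => if i ∈ X then T else Finset.univ)) := by
    intro f hf
    simp only [hsBad, Finset.mem_filter, Finset.mem_univ, true_and] at hf
    obtain ⟨T, hT, hTc⟩ := Finset.exists_superset_card_eq (s := X.image f) (n := r)
      (by omega) (by simp; omega)
    simp only [Finset.mem_biUnion, Finset.mem_powersetCard, Finset.subset_univ, true_and,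
      Fintype.mem_piFinset]
    refine ⟨T, hTc, fun i => ?_⟩
    split_ifs with hi
    · exact hT (Finset.mem_image_of_mem f hi)
    · simp
  have hcard : (hsBad n q X).card ≤ q.choose r * (r ^ m * q ^ (n - m)) := by
    refine (Finset.card_le_card hsub).trans ?_
    refine (Finset.card_biUnion_le_card_mul _ _ (r ^ m * q ^ (n - m)) ?_).trans ?_
    · intro T hT
      rw [Finset.mem_powersetCard] at hT
      rw [Fintype.card_piFinset]
      simp only [apply_ite Finset.card, hT.2, Finset.card_univ, Fintype.card_fin]
      rw [Finset.prod_ite]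
      simp only [Finset.prod_const, Finset.filter_mem_eq_inter, Finset.univ_inter]
      have : (Finset.univ.filter (fun i => i ∉ X)).card = n - m := by
        rw [Finset.filter_not, Finset.filter_mem_eq_inter, Finset.univ_inter,
          Finset.card_univ_diff, Fintype.card_fin]
      rw [this]
    · rw [Finset.card_powersetCard]; simp
  calc (hsBad n q X).card * 2 ^ m ≤ q.choose r * (r ^ m * q ^ (n - m)) * 2 ^ m := by gcongr
    _ = (q.choose r * r ^ m * 2 ^ m) * q ^ (n - m) := by ring
    _ ≤ q ^ m * q ^ (n - m) := by gcongr; exact hs_key q m r hr hq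
    _ = q ^ n := by rw [← pow_add]; congr 1; omega

/-- A function with large image on `X` isolates at least half of `X`. -/
theorem hs_isolate {α β : Type*} [DecidableEq α] [DecidableEq β] (X : Finset α) (f : α → β)
    (h : 3 * X.card ≤ 4 * (X.image f).card) :
    X.card ≤ 2 * (X.filter fun x => X.filter (fun y => f y = f x) = {x}).card := by
  set Y := X.filter fun x => X.filter (fun y => f y = f x) = {x} with hY
  have hYX : Y ⊆ X := Finset.filter_subset _ _
  have h1 : (X.image f).card ≤ (Y.image f).card + ((X \ Y).image f).card := by
    rw [← Finset.union_sdiff_of_subset hYX, Finset.image_union]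
    simpa [Finset.union_sdiff_of_subset hYX] using
      Finset.card_union_le (Y.image f) ((X \ Y).image f)
  have h2 : (Y.image f).card ≤ Y.card := Finset.card_image_le
  have h3 : ((X \ Y).image f).card * 2 ≤ (X \ Y).card := by
    refine Finset.mul_card_image_le_card (f := f) (s := X \ Y) 2 ?_ |> fun h => by
      rw [mul_comm]; exact h
    intro b hb
    obtain ⟨x, hx, rfl⟩ := Finset.mem_image.1 hb
    obtain ⟨hxX, hxY⟩ := Finset.mem_sdiff.1 hx
    have hne : X.filter (fun y => f y = f x) ≠ {x} := fun h => hxY (by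
      rw [hY, Finset.mem_filter]; exact ⟨hxX, h⟩)
    obtain ⟨z, hz, hzx⟩ : ∃ z ∈ X.filter (fun y => f y = f x), z ≠ x := by
      by_contra! hcon
      apply hne
      apply Finset.eq_singleton_iff_unique_mem.2
      exact ⟨by simp [hxX], hcon⟩
    rw [Finset.mem_filter] at hz
    have hzY : z ∉ Y := by
      intro hzY
      rw [hY, Finset.mem_filter] at hzY
      have : x ∈ X.filter (fun y => f y = f z) := by simp [hxX, hz.2]
      rw [hzY.2, Finset.mem_singleton] at this
      exact hzx this.symm
    have : ({x, z} : Finset α) ⊆ (X \ Y).filter (fun y => f y = f x) := by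
      intro w hw
      simp only [Finset.mem_insert, Finset.mem_singleton] at hw
      rcases hw with rfl | rfl
      · simp [hxX, hxY]
      · simp [hz.1, hz.2, hzY]
    calc 2 = ({x, z} : Finset α).card := (Finset.card_pair hzx.symm).symm
      _ ≤ _ := Finset.card_le_card this
  have h4 : (X \ Y).card + Y.card = X.card := Finset.card_sdiff_add_card_eq_card hYX
  omega

theorem hs_family (n q k L : ℕ) (hq : 1024 * k ≤ q) (hq0 : 0 < q) (hL : 2 * n ≤ 2 ^ L)
    (hn : 0 < n) :
    ∃ F : Fin L → Fin n → Fin q, ∀ X : Finset (Fin n), X.Nonempty → X.card ≤ k →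
      ∃ t, F t ∉ hsBad n q X := by
  classical
  by_contra! hcon
  have hsub : (Finset.univ : Finset (Fin L → Fin n → Fin q)) ⊆
      ((Finset.univ.erase (∅ : Finset (Fin n))).filter (fun X => X.card ≤ k)).biUnion
        (fun X => Fintype.piFinset (fun _ : Fin L => hsBad n q X)) := by
    intro F _
    obtain ⟨X, hX, hk, hb⟩ := hcon F
    simp only [Finset.mem_biUnion, Finset.mem_filter, Finset.mem_erase, Finset.mem_univ, and_true,
      Fintype.mem_piFinset]
    exact ⟨X, ⟨hX.ne_empty, hk⟩, hb⟩
  have hc := (Finset.card_le_card hsub).trans Finset.card_biUnion_le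
  simp only [Fintype.card_piFinset, Finset.prod_const, Finset.card_univ, Fintype.card_fin,
    Fintype.card_fun] at hc
  have hcR : ((q : ℝ) ^ n) ^ L ≤ ∑ X ∈ (Finset.univ.erase (∅ : Finset (Fin n))).filter
      (fun X => X.card ≤ k), ((hsBad n q X).card : ℝ) ^ L := by exact_mod_cast hc
  have hQ : (0 : ℝ) < ((q : ℝ) ^ n) ^ L := by positivity
  set a : ℝ := (1 / 2) ^ L with ha
  have ha0 : 0 < a := by positivity
  have hterm : ∀ X ∈ (Finset.univ.erase (∅ : Finset (Fin n))).filter (fun X => X.card ≤ k),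
      ((hsBad n q X).card : ℝ) ^ L ≤ ((q : ℝ) ^ n) ^ L * a ^ X.card := by
    intro X hX
    have hk : X.card ≤ k := (Finset.mem_filter.1 hX).2
    have hb := hs_bad_card n q X (by omega)
    have hb' : ((hsBad n q X).card : ℝ) * 2 ^ X.card ≤ (q : ℝ) ^ n := by exact_mod_cast hb
    have : ((hsBad n q X).card : ℝ) ≤ (q : ℝ) ^ n * (1 / 2) ^ X.card := by
      rw [one_div, inv_pow, ← div_eq_mul_inv, le_div_iff₀ (by positivity)]; exact hb'
    calc ((hsBad n q X).card : ℝ) ^ L ≤ ((q : ℝ) ^ n * (1 / 2) ^ X.card) ^ L := by gcongr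
      _ = _ := by rw [mul_pow, ha, ← pow_mul (1 / 2 : ℝ), ← pow_mul (1 / 2 : ℝ), mul_comm L]
  have h1 := hcR.trans (Finset.sum_le_sum hterm)
  rw [← Finset.mul_sum] at h1
  have h2 : (1 : ℝ) ≤ ∑ X ∈ (Finset.univ.erase (∅ : Finset (Fin n))).filter
      (fun X => X.card ≤ k), a ^ X.card := by
    by_contra! hlt
    nlinarith
  have h3 : ∑ X ∈ (Finset.univ.erase (∅ : Finset (Fin n))).filter
      (fun X => X.card ≤ k), a ^ X.card ≤
      ∑ X ∈ Finset.univ.erase (∅ : Finset (Fin n)), a ^ X.card :=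
    Finset.sum_le_sum_of_subset_of_nonneg (Finset.filter_subset _ _)
      (fun _ _ _ => by positivity)
  have h4 : ∑ X ∈ Finset.univ.erase (∅ : Finset (Fin n)), a ^ X.card + 1 = (a + 1) ^ n := by
    have := Fintype.sum_pow_mul_eq_add_pow (Fin n) a 1
    simp only [one_pow, mul_one, Fintype.card_fin] at this
    rw [← this, ← Finset.sum_erase_add _ _ (Finset.mem_univ (∅ : Finset (Fin n)))]
    simp
  have hna : (n : ℝ) * a ≤ 1 / 2 := by
    have : (2 : ℝ) * n ≤ 2 ^ L := by exact_mod_cast hL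
    rw [ha, one_div, inv_pow, ← div_eq_mul_inv, div_le_iff₀ (by positivity)]
    linarith
  have h5 : (a + 1) ^ n ≤ Real.exp (1 / 2) := by
    calc (a + 1) ^ n ≤ Real.exp a ^ n := by
          gcongr; exact Real.add_one_le_exp a
      _ = Real.exp (n * a) := by rw [← Real.exp_nat_mul]
      _ ≤ _ := Real.exp_le_exp.2 hna
  have h6 : Real.exp (1 / 2) ^ 2 = Real.exp 1 := by
    rw [← Real.exp_nat_mul]; norm_num
  have h7 := Real.exp_one_lt_d9
  nlinarith [Real.exp_pos (1 / 2)]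


/-- There is an absolute constant `C > 0` such that for all integers
`n ≥ 2` and all `k` with `1 ≤ k ≤ n`, there exists an `(n,k)`-half-selector of
length at most `C·k·log n` (log base 2).

An `(n,k)`-half-selector is a finite sequence `S : Fin ℓ → Finset (Fin n)` such
that for every `X ⊆ {0,…,n−1}` with `|X| ≤ k`, at least `|X|/2` of the elements
`x ∈ X` admit an index `i < ℓ` with `S i ∩ X = {x}` (expressed here via a subset
`Y ⊆ X` of singled-out elements with `|X| ≤ 2·|Y|`). -/
theorem half_selector_exists :
    ∃ C : ℝ, 0 < C ∧
      ∀ n k : ℕ, 2 ≤ n → 1 ≤ k → k ≤ n →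
        ∃ (ℓ : ℕ) (S : Fin ℓ → Finset (Fin n)),
          (∀ X : Finset (Fin n), X.card ≤ k →
            ∃ Y ⊆ X, X.card ≤ 2 * Y.card ∧
              ∀ x ∈ Y, ∃ i : Fin ℓ, S i ∩ X = {x}) ∧
          (ℓ : ℝ) ≤ C * (k : ℝ) * Real.logb 2 n := by

  refine ⟨3072, by norm_num, fun n k hn hk _ => ?_⟩
  have hL : 2 * n ≤ 2 ^ (Nat.log 2 n + 2) := by
    have := Nat.lt_pow_succ_log_self (b := 2) (by norm_num) n
    rw [pow_succ]
    simp only [Nat.succ_eq_add_one] at this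
    omega
  set L := Nat.log 2 n + 2 with hLdef
  obtain ⟨F, hF⟩ := hs_family n (1024 * k) k L le_rfl (by omega) hL (by omega)
  refine ⟨L * (1024 * k), fun i => Finset.univ.filter
    (fun x => F (finProdFinEquiv.symm i).1 x = (finProdFinEquiv.symm i).2), ?_, ?_⟩
  · intro X hX
    rcases X.eq_empty_or_nonempty with rfl | hne
    · exact ⟨∅, by simp, by simp, by simp⟩
    · obtain ⟨t, ht⟩ := hF X hne hX
      simp only [hsBad, Finset.mem_filter, Finset.mem_univ, true_and, not_le] at ht
      refine ⟨_, Finset.filter_subset _ _, hs_isolate X (F t) ht.le, fun x hx => ?_⟩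
      refine ⟨finProdFinEquiv (t, F t x), ?_⟩
      rw [← (Finset.mem_filter.1 hx).2]
      ext y
      simp [and_comm]
  · have h1 : (Nat.log 2 n : ℝ) ≤ Real.logb 2 n := by
      exact_mod_cast Real.natLog_le_logb n 2
    have h2 : (1 : ℝ) ≤ Real.logb 2 n := by
      rw [Real.le_logb_iff_rpow_le (by norm_num) (by positivity)]
      simpa using (by exact_mod_cast hn : (2 : ℝ) ≤ n)
    have h3 : (L : ℝ) ≤ 3 * Real.logb 2 n := by
      rw [hLdef]; push_cast; linarith
    push_cast
    have hk0 : (0 : ℝ) ≤ k := Nat.cast_nonneg k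
    nlinarith [mul_le_mul_of_nonneg_left h3 hk0]
end

section
/- Let v be a vertex of a digraph and let S be a subset of scc(v) with v ∈ S such that scc(v) \ S is nonempty. Then there exist vertices w ∈ scc(v) \ S and u ∈ S such that there is an edge from w to u (i.e., E w u holds). -/
/-- `Reach E u w`: there is a directed path (possibly of length 0) from `u` to `w`. -/
def Reach {V : Type*} (E : V → V → Prop) (u w : V) : Prop :=
  ∃ (m : ℕ) (p : ℕ → V), p 0 = u ∧ p m = w ∧ ∀ i < m, E (p i) (p (i + 1))

/-- `MutReach E u w`: `u` and `w` are mutually reachable. -/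
def MutReach {V : Type*} (E : V → V → Prop) (u w : V) : Prop :=
  Reach E u w ∧ Reach E w u

/-- The strongly connected component of `v`: all vertices mutually reachable with `v`. -/
def scc {V : Type*} (E : V → V → Prop) (v : V) : Set V :=
  {u | MutReach E v u}

theorem Reach.snoc_edge {V : Type*} {E : V → V → Prop} {a b c : V}
    (h : Reach E a b) (e : E b c) : Reach E a c := by
  obtain ⟨m, p, h0, hm, hp⟩ := h
  refine ⟨m + 1, fun i => if i ≤ m then p i else c, by simpa using h0, by simp, ?_⟩
  intro i hi
  rcases Nat.lt_or_ge i m with h | h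
  · have h1 : i ≤ m := h.le
    have h2 : i + 1 ≤ m := h
    simpa [h1, h2] using hp i h
  · have h1 : i = m := by omega
    subst h1
    simpa [hm] using e

/-- Let `v` be a vertex of a digraph and `S ⊆ scc(v)` with `v ∈ S`
such that `scc(v) \ S` is nonempty. Then there exist vertices `w ∈ scc(v) \ S`
and `u ∈ S` with an edge from `w` to `u`. -/
theorem scc_boundary_edge
    {V : Type*} (E : V → V → Prop) (v : V) (S : Set V)
    (hSsub : S ⊆ scc E v) (hvS : v ∈ S)
    (hne : (scc E v \ S).Nonempty) :
    ∃ w u : V, w ∈ scc E v \ S ∧ u ∈ S ∧ E w u := by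
  obtain ⟨x, hx, hxS⟩ := hne
  obtain ⟨hvx, m, p, h0, hm, hp⟩ := hx
  by_contra hcon
  have key : ∀ i, i ≤ m → Reach E v (p i) ∧ p i ∉ S := by
    intro i
    induction i with
    | zero =>
      intro _
      rw [h0]
      exact ⟨hvx, hxS⟩
    | succ i ih =>
      intro hi
      obtain ⟨h1, h2⟩ := ih (by omega)
      have e := hp i (by omega)
      refine ⟨h1.snoc_edge e, fun hS => hcon ⟨p i, p (i + 1), ⟨⟨h1, ?_⟩, h2⟩, hS, e⟩⟩
      refine ⟨m - i, fun k => p (i + k), by simp, ?_, ?_⟩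
      · have h3 : i + (m - i) = m := by omega
        simp only [h3, hm]
      · intro k hk
        exact hp (i + k) (by omega)
  exact (key m le_rfl).2 (hm ▸ hvS)
end

section
/- Let n ≥ 2, let j ≥ 0, and for each q = 0, 1, …, j let F_q be an (n,2^q)-half-selector. Let A ⊆ {0, …, n−1} be a set with |A| ≤ 2^j. Define sets C_j ⊇ C_{j−1} ⊇ … ⊇ C_{−1} by C_j = A and, for q = j, j−1, …, 0, C_{q−1} = {x ∈ C_q : no set S occurring in F_q satisfies S ∩ C_q = {x}}. Then C_{−1} = ∅; that is, every element x of A is singled out at some stage q (meaning some set S of F_q satisfies S ∩ C_q = {x}). -/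
/-- Let `n ≥ 2`, `j ≥ 0`, and for each `q = 0,…,j` let `F q` be an
`(n, 2^q)`-half-selector (a list of subsets of `{0,…,n−1}` such that for every
`X` with `|X| ≤ 2^q`, at least `|X|/2` elements `x ∈ X` are singled out by some
set `s ∈ F q`, i.e. `s ∩ X = {x}`). Let `A ⊆ {0,…,n−1}` with `|A| ≤ 2^j`.
Define `C_j = A` and, for `q = j, j−1, …, 0`,
`C_{q−1} = {x ∈ C_q : no set s of F q satisfies s ∩ C_q = {x}}`.
Then `C_{−1} = ∅`; that is, every element of `A` is singled out at some stage.

Here we index with a shift: `C (q+1)` stands for the paper's `C_q`, so the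
paper's `C_{−1}` is `C 0`. -/
theorem half_selector_cascade_empties
    {n : ℕ} (hn : 2 ≤ n) (j : ℕ)
    (F : ℕ → List (Finset (Fin n)))
    (hF : ∀ q ≤ j, ∀ X : Finset (Fin n), X.card ≤ 2 ^ q →
      ∃ Y ⊆ X, X.card ≤ 2 * Y.card ∧
        ∀ x ∈ Y, ∃ s ∈ F q, s ∩ X = {x})
    (A : Finset (Fin n)) (hA : A.card ≤ 2 ^ j)
    (C : ℕ → Finset (Fin n))
    (hCtop : C (j + 1) = A)
    (hCstep : ∀ q ≤ j, ∀ x : Fin n,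
      x ∈ C q ↔ x ∈ C (q + 1) ∧ ¬ ∃ s ∈ F q, s ∩ C (q + 1) = {x}) :
    C 0 = ∅ := by
  have key : ∀ q ≤ j, (C (q + 1)).card ≤ 2 ^ q → 2 * (C q).card ≤ 2 ^ q := by
    intro q hq hc
    obtain ⟨Y, hYX, hY, hs⟩ := hF q hq _ hc
    have hsub : C q ⊆ C (q + 1) \ Y := by
      intro x hx
      have h := (hCstep q hq x).1 hx
      exact Finset.mem_sdiff.2 ⟨h.1, fun hxY => h.2 (hs x hxY)⟩
    have h1 := Finset.card_le_card hsub
    have h2 := Finset.card_sdiff_add_card_eq_card hYX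
    omega
  have bound : ∀ d ≤ j, (C (j - d + 1)).card ≤ 2 ^ (j - d) := by
    intro d
    induction d with
    | zero =>
      intro _
      simpa [hCtop] using hA
    | succ d ih =>
      intro hd
      have h := key (j - d) (by omega) (ih (by omega))
      obtain ⟨m, hm⟩ : ∃ m, j - d = m + 1 := ⟨j - d - 1, by omega⟩
      have hm' : j - (d + 1) = m := by omega
      rw [hm, pow_succ] at h
      rw [hm']
      omega
  have hb := bound j le_rfl
  rw [Nat.sub_self] at hb
  have h0 := key 0 (Nat.zero_le j) hb
  rw [pow_zero] at h0
  exact Finset.card_eq_zero.1 (by omega)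
end
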